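/- Let G_ω be a Grigorchuk 2-group. If ω is an r-homogeneous sequence, then the period growth function of G_ω satisfies π_ω(n) ≾ n^{r/2}. In particular, the degree of period growth of the first Grigorchuk group (defined by the 3-periodic sequence ω = 012 012 012 …, which is 3-homogeneous) is at most n^{3/2}. -/

import Mathlib

noncomputable section

open Equiv

namespace Spinal

/-- The letter `q` of the alphabet `{1,…,q}` (here `q = m + 2`). -/
def qtop (m : ℕ) : Fin (m + 2) := Fin.last (m + 1)

/-- The letter `1` of the alphabet. -/
def qone (m : ℕ) : Fin (m + 2) := 0


theorem qone_ne_qtop (m : ℕ) : qone m ≠ qtop m := by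
  simp [qone, qtop, Fin.ext_iff]

/-- The action of an alphabet permutation on the first letter of a word. -/
def rootFun (m : ℕ) (a : Equiv.Perm (Fin (m + 2))) :
    List (Fin (m + 2)) → List (Fin (m + 2))
  | [] => []
  | y :: w => a y :: w

theorem rootFun_leftInv (m : ℕ) (a : Equiv.Perm (Fin (m + 2))) (w : List (Fin (m + 2))) :
    rootFun m a.symm (rootFun m a w) = w := by
  cases w <;> simp [rootFun]

/-- The tree automorphism induced by a root permutation. -/
def rootAut (m : ℕ) (a : Equiv.Perm (Fin (m + 2))) : Equiv.Perm (List (Fin (m + 2))) where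
  toFun := rootFun m a
  invFun := rootFun m a.symm
  left_inv w := rootFun_leftInv m a w
  right_inv w := by simpa using rootFun_leftInv m a.symm w

variable {GB : Type*} [Group GB]

/-- The spinal action of `b : G_B` determined by the sequence `ω` of homomorphisms:
at the vertex `q^n 1` the next letter is moved by `ω n b` (0-indexed, so `ω 0` is the
paper's `ω₁`). -/
def spinalFun (m : ℕ) (ω : ℕ → GB →* Equiv.Perm (Fin (m + 2))) (b : GB) :
    ℕ → List (Fin (m + 2)) → List (Fin (m + 2))
  | _, [] => []
  | n, y :: w =>
    if y = qtop m then y :: spinalFun m ω b (n + 1) w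
    else if y = qone m then
      y :: (match w with
            | [] => []
            | z :: w' => ω n b z :: w')
    else y :: w

theorem spinalFun_leftInv (m : ℕ) (ω : ℕ → GB →* Equiv.Perm (Fin (m + 2)))
    (b : GB) (n : ℕ) (w : List (Fin (m + 2))) :
    spinalFun m ω b⁻¹ n (spinalFun m ω b n w) = w := by
  induction w generalizing n with
  | nil => simp [spinalFun]
  | cons y w ih =>
    by_cases h1 : y = qtop m
    · simp [spinalFun, h1, ih]
    · by_cases h2 : y = qone m
      · match w with
        | [] => simp [spinalFun, h1, h2]
        | z :: w' => simp [spinalFun, h1, h2, map_inv, qone_ne_qtop]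
      · simp [spinalFun, h1, h2]

/-- The tree automorphism induced by `b : G_B` via the sequence `ω`. -/
def spinalAut (m : ℕ) (ω : ℕ → GB →* Equiv.Perm (Fin (m + 2))) (b : GB) :
    Equiv.Perm (List (Fin (m + 2))) where
  toFun := spinalFun m ω b 0
  invFun := spinalFun m ω b⁻¹ 0
  left_inv w := spinalFun_leftInv m ω b 0 w
  right_inv w := by simpa using spinalFun_leftInv m ω b⁻¹ 0 w

/-- The canonical generating set `S_ω = A ∪ B_ω` (non-identity induced automorphisms). -/
def genSet (m : ℕ) (GA : Subgroup (Equiv.Perm (Fin (m + 2))))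
    (ω : ℕ → GB →* Equiv.Perm (Fin (m + 2))) : Set (Equiv.Perm (List (Fin (m + 2)))) :=
  ((rootAut m '' (GA : Set (Equiv.Perm (Fin (m + 2))))) ∪
    Set.range fun b : GB => spinalAut m ω b) \ {1}

/-- The spinal group `G_ω`, as a subgroup of the permutation group of the vertex set
of the `(m+2)`-regular rooted tree. -/
def spinalGroup (m : ℕ) (GA : Subgroup (Equiv.Perm (Fin (m + 2))))
    (ω : ℕ → GB →* Equiv.Perm (Fin (m + 2))) : Subgroup (Equiv.Perm (List (Fin (m + 2)))) :=
  Subgroup.closure (genSet m GA ω)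

/-- The defining conditions on the data `(G_A, G_B, ω)` of a spinal group:
`G_A` is a transitive (hence faithful) group of permutations of the alphabet,
every `ω n` is an epimorphism onto `G_A`, and `ω ∈ Ω̂`: from every index on, the kernels
of the remaining homomorphisms cover `G_B` and intersect trivially. -/
structure SpinalData (m : ℕ) (GA : Subgroup (Equiv.Perm (Fin (m + 2))))
    (ω : ℕ → GB →* Equiv.Perm (Fin (m + 2))) : Prop where
  transitive : ∀ i j : Fin (m + 2), ∃ a ∈ GA, a i = j
  range_eq : ∀ n, (ω n).range = GA
  kernels_cover : ∀ i : ℕ, ∀ b : GB, ∃ j, i ≤ j ∧ ω j b = 1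
  kernels_sep : ∀ i : ℕ, ∀ b : GB, (∀ j, i ≤ j → ω j b = 1) → b = 1

/-- Word length of a group element with respect to a set of generators. -/
def wordLength {G : Type*} [Group G] (S : Set G) (g : G) : ℕ :=
  sInf {n | ∃ l : List G, l.length = n ∧ (∀ x ∈ l, x ∈ S) ∧ l.prod = g}

/-- The word growth function `γ_ω` of the spinal group with respect to `S_ω`. -/
def growth (m : ℕ) (GA : Subgroup (Equiv.Perm (Fin (m + 2))))
    (ω : ℕ → GB →* Equiv.Perm (Fin (m + 2))) (n : ℕ) : ℕ :=
  Nat.card {g : Equiv.Perm (List (Fin (m + 2))) //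
    g ∈ spinalGroup m GA ω ∧ wordLength (genSet m GA ω) g ≤ n}

/-- The period growth function `π_ω`: the largest order of an element of word length
at most `n`. -/
def periodGrowth (m : ℕ) (GA : Subgroup (Equiv.Perm (Fin (m + 2))))
    (ω : ℕ → GB →* Equiv.Perm (Fin (m + 2))) (n : ℕ) : ℕ :=
  sSup (orderOf '' {g : Equiv.Perm (List (Fin (m + 2))) |
    g ∈ spinalGroup m GA ω ∧ wordLength (genSet m GA ω) g ≤ n})

/-- Abstract letters for words over `S_ω`: an `A`-letter is (induced by) a permutation
of the alphabet, a `B`-letter is (induced by) an element of `G_B`. -/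
abbrev Letter (m : ℕ) (GB : Type*) := Equiv.Perm (Fin (m + 2)) ⊕ GB

/-- Evaluation of an abstract letter as a tree automorphism. -/
def evalLetter (m : ℕ) (ω : ℕ → GB →* Equiv.Perm (Fin (m + 2))) :
    Letter m GB → Equiv.Perm (List (Fin (m + 2))) :=
  Sum.elim (rootAut m) (spinalAut m ω)

/-- The list of `A`-letters of a word, in order. -/
def aLetters {m : ℕ} {GB : Type*} : List (Letter m GB) → List (Equiv.Perm (Fin (m + 2))) :=
  List.filterMap fun x => match x with
    | Sum.inl a => some a
    | Sum.inr _ => none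

/-- The list of `B`-letters of a word, in order. -/
def bLetters {m : ℕ} {GB : Type*} : List (Letter m GB) → List GB :=
  List.filterMap fun x => match x with
    | Sum.inl _ => none
    | Sum.inr b => some b

/-- A word is reduced if its letters alternate between `A`-letters and `B`-letters and
no letter is the identity. -/
def IsReduced {m : ℕ} (F : List (Letter m GB)) : Prop :=
  List.Chain' (fun x y => x.isLeft ≠ y.isLeft) F ∧
    Sum.inl (1 : Equiv.Perm (Fin (m + 2))) ∉ F ∧ Sum.inr (1 : GB) ∉ F

open scoped Classical in
/-- One step of the (complete, confluent) simple reduction process: prepend a letter to an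
already reduced word and reduce. -/
def reduceStep {m : ℕ} : Letter m GB → List (Letter m GB) → List (Letter m GB)
  | Sum.inl a, [] => if a = 1 then [] else [Sum.inl a]
  | Sum.inr b, [] => if b = 1 then [] else [Sum.inr b]
  | Sum.inl a, Sum.inl a' :: t => if a * a' = 1 then t else Sum.inl (a * a') :: t
  | Sum.inr b, Sum.inr b' :: t => if b * b' = 1 then t else Sum.inr (b * b') :: t
  | Sum.inl a, y :: t => if a = 1 then y :: t else Sum.inl a :: y :: t
  | Sum.inr b, y :: t => if b = 1 then y :: t else Sum.inr b :: y :: t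

/-- The reduced form of a word, obtained by simple reductions. -/
def reduceWord {m : ℕ} (F : List (Letter m GB)) : List (Letter m GB) :=
  F.foldr reduceStep []

open scoped Classical in
/-- The (unreduced) projection of a word, representing an element of the first-level
stabilizer, to the coordinate `i` of the first level: scanning the word from the left
while accumulating the product `g` of the `A`-letters, a `B`-letter `b` contributes the
letter `b` at the coordinate `g(q)` and the letter `ω₁(b)` at the coordinate `g(1)`. -/
def projWord (m : ℕ) (ω0 : GB →* Equiv.Perm (Fin (m + 2))) (i : Fin (m + 2)) :
    List (Letter m GB) → Equiv.Perm (Fin (m + 2)) → List (Letter m GB)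
  | [], _ => []
  | Sum.inl a :: F, g => projWord m ω0 i F (g * a)
  | Sum.inr b :: F, g =>
      ((if g (qtop m) = i then [Sum.inr b] else []) ++
        (if g (qone m) = i then [Sum.inl (ω0 b)] else [])) ++ projWord m ω0 i F g

/-- The list of the `q^r` (reduced) words at level `r` of the depth-`r` decomposition
of a word. -/
def levelWords (m : ℕ) :
    (ℕ → GB →* Equiv.Perm (Fin (m + 2))) → ℕ → List (Letter m GB) →
      List (List (Letter m GB))
  | _, 0, F => [F]
  | ω, r + 1, F =>
      (List.finRange (m + 2)).flatMap fun i =>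
        levelWords m (fun n => ω (n + 1)) r (reduceWord (projWord m (ω 0) i F 1))

/-- `|L_r(F)|`: the total length of level `r` of the depth-`r` decomposition of `F`. -/
def levelLength (m : ℕ) (ω : ℕ → GB →* Equiv.Perm (Fin (m + 2))) (r : ℕ)
    (F : List (Letter m GB)) : ℕ :=
  ((levelWords m ω r F).map List.length).sum

/-- The triangular weight of a letter: `A`-letters have weight `τ₀ = 1 - η^r`; a
`B`-letter `b` has weight `τ_i = η^r + η^(r-i) - 1` where `i` is the smallest (1-based)
index with `ω_i(b) = 1`. -/
def letterWeight (m : ℕ) (ω : ℕ → GB →* Equiv.Perm (Fin (m + 2))) (η : ℝ) (r : ℕ) :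
    Letter m GB → ℝ
  | Sum.inl _ => 1 - η ^ r
  | Sum.inr b => η ^ r + η ^ (r - (sInf {j | ω j b = 1} + 1)) - 1

/-- The total triangular weight of a word. -/
def wordWeight (m : ℕ) (ω : ℕ → GB →* Equiv.Perm (Fin (m + 2))) (η : ℝ) (r : ℕ)
    (F : List (Letter m GB)) : ℝ :=
  (F.map (letterWeight m ω η r)).sum

/-- The weight `∂^τ(g)` of a group element: the least total weight of a word over `S_ω`
representing it. -/
def elemWeight (m : ℕ) (GA : Subgroup (Equiv.Perm (Fin (m + 2))))
    (ω : ℕ → GB →* Equiv.Perm (Fin (m + 2))) (η : ℝ) (r : ℕ)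
    (g : Equiv.Perm (List (Fin (m + 2)))) : ℝ :=
  sInf {x : ℝ | ∃ F : List (Letter m GB),
    (∀ a : Equiv.Perm (Fin (m + 2)), Sum.inl a ∈ F → a ∈ GA) ∧
    (F.map (evalLetter m ω)).prod = g ∧ wordWeight m ω η r F = x}

/-! ### Formal words and their evaluation in the case of a two-letter alphabet -/

/-- The formal group on the root permutations and the level group. -/
abbrev FormalGroup (GB : Type*) [Group GB] := Monoid.Coprod (Equiv.Perm (Fin (0 + 2))) GB

/-- The nontrivial permutation of the two-letter alphabet. -/
def flip2 : Equiv.Perm (Fin (0 + 2)) := Equiv.swap 0 1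

theorem perm_two_eq (τ : Equiv.Perm (Fin (0 + 2))) : τ = 1 ∨ τ = flip2 := by
  revert τ; unfold flip2; decide

theorem flip2_ne_one : flip2 ≠ 1 := by unfold flip2; decide

theorem flip2_mul_flip2 : flip2 * flip2 = 1 := by unfold flip2; decide

theorem perm_two_comm (τ υ : Equiv.Perm (Fin (0 + 2))) : τ * υ = υ * τ := by
  revert τ υ; decide

theorem flip2_zero : flip2 0 = 1 := by unfold flip2; decide

theorem flip2_one : flip2 1 = 0 := by unfold flip2; decide

theorem perm_two_mul_self (τ : Equiv.Perm (Fin (0 + 2))) : τ * τ = 1 := by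
  revert τ; decide

/-- Root permutations act on the tree by automorphisms. -/
def rootHom : Equiv.Perm (Fin (0 + 2)) →* Equiv.Perm (List (Fin (0 + 2))) where
  toFun := rootAut 0
  map_one' := by ext1 w; cases w <;> rfl
  map_mul' a b := by ext1 w; cases w <;> rfl

@[simp] theorem spinalFun_nil (ω : ℕ → GB →* Equiv.Perm (Fin (0 + 2))) (b : GB) (s : ℕ) :
    spinalFun 0 ω b s [] = [] := rfl

theorem spinalFun_one (ω : ℕ → GB →* Equiv.Perm (Fin (0 + 2))) (b : GB) (s : ℕ)
    (w : List (Fin (0 + 2))) :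
    spinalFun 0 ω b s (1 :: w) = 1 :: spinalFun 0 ω b (s + 1) w := by
  cases w <;> rfl

theorem spinalFun_zero (ω : ℕ → GB →* Equiv.Perm (Fin (0 + 2))) (b : GB) (s : ℕ)
    (w : List (Fin (0 + 2))) :
    spinalFun 0 ω b s (0 :: w) = 0 :: rootFun 0 (ω s b) w := by
  cases w <;> rfl

theorem fin_two_cases (y : Fin (0 + 2)) : y = 0 ∨ y = 1 := by
  revert y; decide

theorem spinalFun_id (ω : ℕ → GB →* Equiv.Perm (Fin (0 + 2))) (s : ℕ)
    (w : List (Fin (0 + 2))) : spinalFun 0 ω 1 s w = w := by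
  induction w generalizing s with
  | nil => rfl
  | cons y w ih =>
    rcases fin_two_cases y with rfl | rfl
    · rw [spinalFun_zero]; cases w <;> simp [rootFun]
    · rw [spinalFun_one, ih]

theorem spinalFun_mul (ω : ℕ → GB →* Equiv.Perm (Fin (0 + 2))) (b c : GB) (s : ℕ)
    (w : List (Fin (0 + 2))) :
    spinalFun 0 ω (b * c) s w = spinalFun 0 ω b s (spinalFun 0 ω c s w) := by
  induction w generalizing s with
  | nil => rfl
  | cons y w ih =>
    rcases fin_two_cases y with rfl | rfl
    · simp only [spinalFun_zero]; cases w <;> simp [rootFun]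
    · simp only [spinalFun_one, ih]

/-- The spinal action read off from the sequence shifted by `s`. -/
def spinalHom (ω : ℕ → GB →* Equiv.Perm (Fin (0 + 2))) (s : ℕ) :
    GB →* Equiv.Perm (List (Fin (0 + 2))) where
  toFun b :=
    { toFun := spinalFun 0 ω b s
      invFun := spinalFun 0 ω b⁻¹ s
      left_inv := spinalFun_leftInv 0 ω b s
      right_inv := fun w => by simpa using spinalFun_leftInv 0 ω b⁻¹ s w }
  map_one' := by ext1 w; exact spinalFun_id ω s w
  map_mul' b c := by ext1 w; exact spinalFun_mul ω b c s w

/-- Evaluation of formal words with respect to the sequence shifted by `s`. -/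
def ev (ω : ℕ → GB →* Equiv.Perm (Fin (0 + 2))) (s : ℕ) :
    FormalGroup GB →* Equiv.Perm (List (Fin (0 + 2))) :=
  Monoid.Coprod.lift rootHom (spinalHom ω s)

open Monoid.Coprod (inl inr)

/-- The alternating formal word with prescribed level letters. -/
def alt : List GB → FormalGroup GB
  | [] => 1
  | b :: w => inl flip2 * inr b * alt w

theorem alt_append (u v : List GB) : alt (u ++ v) = alt u * alt v := by
  induction u with
  | nil => simp [alt]
  | cons b u ih => simp [alt, ih, mul_assoc]

/-- The total root permutation of a formal word. -/
def par : FormalGroup GB →* Equiv.Perm (Fin (0 + 2)) := Monoid.Coprod.lift (MonoidHom.id _) 1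

/-- The total level letter of a formal word. -/
def cl : FormalGroup GB →* GB := Monoid.Coprod.lift 1 (MonoidHom.id _)

@[simp] theorem par_inl (τ : Equiv.Perm (Fin (0 + 2))) :
    par (inl τ : FormalGroup GB) = τ := by simp [par]
@[simp] theorem par_inr (b : GB) : par (inr b : FormalGroup GB) = 1 := by simp [par]
@[simp] theorem cl_inl (τ : Equiv.Perm (Fin (0 + 2))) :
    cl (inl τ : FormalGroup GB) = 1 := by simp [cl]
@[simp] theorem cl_inr (b : GB) : cl (inr b : FormalGroup GB) = b := by simp [cl]

@[simp] theorem cl_alt (w : List GB) : cl (alt w) = w.prod := by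
  induction w with
  | nil => simp [alt]
  | cons b w ih => simp [alt, ih]

theorem par_alt (w : List GB) : par (alt w) = flip2 ^ w.length := by
  induction w with
  | nil => simp [alt]
  | cons b w ih => simp [alt, ih, pow_succ']

theorem par_alt_eq_one_iff (w : List GB) : par (alt w) = 1 ↔ Even w.length := by
  rw [par_alt]
  constructor
  · intro h
    by_contra hn
    obtain ⟨k, hk⟩ := Nat.not_even_iff_odd.mp hn
    rw [hk, pow_succ, pow_mul, pow_two, flip2_mul_flip2] at h
    exact flip2_ne_one (by simpa using h)
  · rintro ⟨k, hk⟩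
    rw [hk, ← two_mul, pow_mul, pow_two, flip2_mul_flip2, one_pow]

/-- The section of an alternating word at an output coordinate. -/
def sec (σ : GB →* Equiv.Perm (Fin (0 + 2))) : Fin (0 + 2) → List GB → FormalGroup GB
  | _, [] => 1
  | i, b :: w => (if i = 0 then inr b else inl (σ b)) * sec σ (flip2 i) w

theorem sec_zero_cons (σ : GB →* Equiv.Perm (Fin (0 + 2))) (b : GB) (w : List GB) :
    sec σ 0 (b :: w) = inr b * sec σ 1 w := by
  simp [sec, flip2_zero]

theorem sec_one_cons (σ : GB →* Equiv.Perm (Fin (0 + 2))) (b : GB) (w : List GB) :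
    sec σ 1 (b :: w) = inl (σ b) * sec σ 0 w := by
  simp [sec, flip2_one]

theorem ev_inl_nil (ω : ℕ → GB →* Equiv.Perm (Fin (0 + 2))) (s : ℕ)
    (τ : Equiv.Perm (Fin (0 + 2))) : ev ω s (inl τ) [] = [] := by
  simp [ev]; rfl

theorem ev_inl_cons (ω : ℕ → GB →* Equiv.Perm (Fin (0 + 2))) (s : ℕ)
    (τ : Equiv.Perm (Fin (0 + 2))) (j : Fin (0 + 2)) (v : List (Fin (0 + 2))) :
    ev ω s (inl τ) (j :: v) = τ j :: v := by
  simp [ev]; rfl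

theorem ev_inl_eq (ω : ℕ → GB →* Equiv.Perm (Fin (0 + 2))) (s : ℕ)
    (τ : Equiv.Perm (Fin (0 + 2))) (v : List (Fin (0 + 2))) :
    ev ω s (inl τ) v = rootFun 0 τ v := by
  simp [ev]; rfl

theorem ev_inr_eq (ω : ℕ → GB →* Equiv.Perm (Fin (0 + 2))) (s : ℕ)
    (b : GB) (v : List (Fin (0 + 2))) : ev ω s (inr b) v = spinalFun 0 ω b s v := by
  simp [ev]; rfl

theorem ev_alt_nil (ω : ℕ → GB →* Equiv.Perm (Fin (0 + 2))) (s : ℕ) (w : List GB) :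
    ev ω s (alt w) [] = [] := by
  induction w with
  | nil => simp [alt]
  | cons b w ih => simp [alt, ih, ev_inl_nil, ev_inr_eq]

theorem ev_alt_cons (ω : ℕ → GB →* Equiv.Perm (Fin (0 + 2))) (s : ℕ) (w : List GB)
    (j : Fin (0 + 2)) (v : List (Fin (0 + 2))) :
    ev ω s (alt w) (j :: v) =
      par (alt w) j :: ev ω (s + 1) (sec (ω s) (par (alt w) j) w) v := by
  induction w with
  | nil => simp [alt, sec]
  | cons b w ih =>
    simp only [alt, map_mul, Equiv.Perm.mul_apply, ih, par_inl, par_inr, Equiv.Perm.one_apply,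
      ev_inr_eq]
    rcases fin_two_cases (par (alt w) j) with h | h <;> rw [h]
    · rw [spinalFun_zero, ev_inl_cons, flip2_zero, sec_one_cons, map_mul, Equiv.Perm.mul_apply,
        ev_inl_eq]
    · rw [spinalFun_one, ev_inl_cons, flip2_one, sec_zero_cons, map_mul, Equiv.Perm.mul_apply,
        ev_inr_eq]

theorem perm_list_pow_eq_one {α : Type*} {g : Equiv.Perm (List α)}
    {k : α → Equiv.Perm (List α)} (hnil : g [] = []) (hcons : ∀ j v, g (j :: v) = j :: k j v)
    {n : ℕ} (hk : ∀ j, k j ^ n = 1) : g ^ n = 1 := by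
  have key : ∀ m j v, (g ^ m) (j :: v) = j :: (k j ^ m) v := by
    intro m
    induction m with
    | zero => intro j v; simp
    | succ m ih => intro j v; simp [pow_succ, hcons, ih]
  have hn : ∀ m, (g ^ m) [] = [] := by
    intro m
    induction m with
    | zero => simp
    | succ m ih => simp [pow_succ, hnil, ih]
  ext1 v
  cases v with
  | nil => simpa using hn n
  | cons j v => simp [key, hk]

theorem ev_alt_pow_of_even (ω : ℕ → GB →* Equiv.Perm (Fin (0 + 2))) (s : ℕ) {w : List GB}
    (hw : par (alt w) = 1) {n : ℕ} (h : ∀ i, ev ω (s + 1) (sec (ω s) i w) ^ n = 1) :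
    ev ω s (alt w) ^ n = 1 :=
  perm_list_pow_eq_one (k := fun j => ev ω (s + 1) (sec (ω s) j w)) (ev_alt_nil ω s w)
    (fun j v => by simp [ev_alt_cons, hw]) h

theorem ev_alt_pow_of_odd (ω : ℕ → GB →* Equiv.Perm (Fin (0 + 2))) (s : ℕ) {w : List GB}
    (hw : par (alt w) ≠ 1) {n : ℕ}
    (h : ev ω (s + 1) (sec (ω s) 0 w * sec (ω s) 1 w) ^ n = 1) :
    ev ω s (alt w) ^ (2 * n) = 1 := by
  have hw' : par (alt w) = flip2 := (perm_two_eq _).resolve_left hw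
  rw [pow_mul]
  refine perm_list_pow_eq_one
    (k := fun j => ev ω (s + 1) (sec (ω s) j w * sec (ω s) (flip2 j) w)) ?_ ?_ ?_
  · simp [pow_two, ev_alt_nil]
  · intro j v
    have hff : flip2 (flip2 j) = j := by
      rw [← Equiv.Perm.mul_apply, flip2_mul_flip2, Equiv.Perm.one_apply]
    simp only [pow_two, Equiv.Perm.mul_apply, ev_alt_cons, hw', hff, map_mul]
  · intro j
    rcases fin_two_cases j with rfl | rfl
    · simpa [flip2_zero] using h
    · have hc : ev ω (s + 1) (sec (ω s) 1 w * sec (ω s) 0 w) =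
          (ev ω (s + 1) (sec (ω s) 0 w))⁻¹ *
            ev ω (s + 1) (sec (ω s) 0 w * sec (ω s) 1 w) *
            ((ev ω (s + 1) (sec (ω s) 0 w))⁻¹)⁻¹ := by
        simp [map_mul]
      simp only [flip2_one]
      rw [hc, conj_pow, h, mul_one, mul_inv_cancel]

/-! ### Lengths up to conjugation -/

/-- Product of a list of pairs of letters. -/
def pairProd (P : List (Equiv.Perm (Fin (0 + 2)) × GB)) : FormalGroup GB :=
  (P.map fun p => (inl p.1 * inr p.2 : FormalGroup GB)).prod

theorem pairProd_nil : pairProd ([] : List (Equiv.Perm (Fin (0 + 2)) × GB)) = 1 := rfl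

theorem pairProd_cons (τ : Equiv.Perm (Fin (0 + 2))) (b : GB)
    (P : List (Equiv.Perm (Fin (0 + 2)) × GB)) :
    pairProd ((τ, b) :: P) = inl τ * inr b * pairProd P := by
  simp [pairProd]

theorem pairProd_append (P Q : List (Equiv.Perm (Fin (0 + 2)) × GB)) :
    pairProd (P ++ Q) = pairProd P * pairProd Q := by
  simp [pairProd]

/-- Up to conjugation, `γ` is a level letter or an alternating word of length less than `n`. -/
def LenLt (n : ℕ) (γ : FormalGroup GB) : Prop :=
  (∃ w : List GB, w.length < n ∧ IsConj γ (alt w)) ∨ ∃ b : GB, IsConj γ (inr b)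

theorem LenLt.of_isConj {n : ℕ} {γ δ : FormalGroup GB} (h : LenLt n δ) (hc : IsConj γ δ) :
    LenLt n γ := by
  rcases h with ⟨w, hw, h⟩ | ⟨b, h⟩
  · exact Or.inl ⟨w, hw, hc.trans h⟩
  · exact Or.inr ⟨b, hc.trans h⟩

theorem isConj_mul_comm {G : Type*} [Group G] (x y : G) : IsConj (x * y) (y * x) :=
  isConj_iff.mpr ⟨y, by group⟩

theorem exists_pairProd_eq (P : List (Equiv.Perm (Fin (0 + 2)) × GB)) :
    ∃ b w, pairProd P = inr b * alt w ∧ w.length ≤ P.length := by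
  induction P with
  | nil => exact ⟨1, [], by simp [pairProd_nil, alt], le_rfl⟩
  | cons p P ih =>
    obtain ⟨τ, c⟩ := p
    obtain ⟨b, w, h, hl⟩ := ih
    rcases perm_two_eq τ with rfl | rfl
    · exact ⟨c * b, w, by simp [pairProd_cons, h, mul_assoc], by simp; omega⟩
    · exact ⟨1, (c * b) :: w, by simp [pairProd_cons, h, alt, mul_assoc], by simpa using hl⟩

theorem lenLt_pairProd {n : ℕ} {P : List (Equiv.Perm (Fin (0 + 2)) × GB)} (hP : P.length < n) :
    LenLt n (pairProd P) := by
  obtain ⟨b, w, h, hl⟩ := exists_pairProd_eq P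
  rcases List.eq_nil_or_concat w with rfl | ⟨v, c, rfl⟩
  · exact Or.inr ⟨b, by rw [h, alt, mul_one]⟩
  · refine Or.inl ⟨v ++ [c * b], by simp at hl ⊢; omega, ?_⟩
    have : (alt (v ++ [c * b]) : FormalGroup GB) = alt (v.concat c) * inr b := by
      simp [alt_append, alt, mul_assoc]
    rw [h, this]
    exact isConj_mul_comm _ _

theorem exists_sec_one_eq (σ : GB →* Equiv.Perm (Fin (0 + 2))) :
    ∀ w : List GB, ∃ P τ, sec σ 1 w = pairProd P * inl τ ∧
      (w.length = 2 * P.length ∧ τ = 1 ∨ w.length = 2 * P.length + 1)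
  | [] => ⟨[], 1, by simp [sec, pairProd_nil], by simp⟩
  | [b] => ⟨[], σ b, by simp [sec, pairProd_nil], by simp⟩
  | b :: c :: w => by
    obtain ⟨P, τ, h, hl⟩ := exists_sec_one_eq σ w
    refine ⟨(σ b, c) :: P, τ, ?_, ?_⟩
    · rw [sec_one_cons, sec_zero_cons, h, pairProd_cons]; simp only [mul_assoc]
    · simp only [List.length_cons]
      rcases hl with ⟨hl, rfl⟩ | hl
      · exact Or.inl ⟨by omega, rfl⟩
      · exact Or.inr (by omega)

theorem lenLt_sec_of_even (σ : GB →* Equiv.Perm (Fin (0 + 2))) {w : List GB} {n : ℕ}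
    (hw : Even w.length) (hn : w.length < 2 * n) (i : Fin (0 + 2)) : LenLt n (sec σ i w) := by
  obtain ⟨k, hk⟩ := hw
  rcases fin_two_cases i with rfl | rfl
  · cases w with
    | nil => exact lenLt_pairProd (P := []) (by simp at hn; simpa using hn)
    | cons b w =>
      obtain ⟨P, τ, h, hl⟩ := exists_sec_one_eq σ w
      simp only [List.length_cons] at hk hn
      have : LenLt n (pairProd ((τ, b) :: P)) := lenLt_pairProd (by simp; omega)
      refine this.of_isConj ?_
      rw [sec_zero_cons, h, pairProd_cons, ← mul_assoc, mul_assoc (inl τ)]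
      exact isConj_mul_comm _ _
  · obtain ⟨P, τ, h, hl⟩ := exists_sec_one_eq σ w
    obtain ⟨hl, rfl⟩ : w.length = 2 * P.length ∧ τ = 1 := hl.resolve_right (by omega)
    rw [h, map_one, mul_one]
    exact lenLt_pairProd (by omega)

theorem lenLt_sec_mul_sec_of_odd (σ : GB →* Equiv.Perm (Fin (0 + 2))) {w : List GB} {n : ℕ}
    (hw : Odd w.length) (hn : w.length < n) : LenLt n (sec σ 0 w * sec σ 1 w) := by
  obtain ⟨k, hk⟩ := hw
  cases w with
  | nil => simp at hk
  | cons b w =>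
    obtain ⟨P, τ, h, hl⟩ := exists_sec_one_eq σ (b :: w)
    obtain ⟨Q, υ, h', hl'⟩ := exists_sec_one_eq σ w
    simp only [List.length_cons] at hk hn hl
    obtain ⟨hl', rfl⟩ : w.length = 2 * Q.length ∧ υ = 1 := hl'.resolve_right (by omega)
    have : LenLt n (pairProd ((τ, b) :: (Q ++ P))) := lenLt_pairProd (by simp; omega)
    refine this.of_isConj ?_
    rw [sec_zero_cons, h, h', pairProd_cons, pairProd_append, map_one, mul_one]
    have := isConj_mul_comm (inr b * (pairProd Q * pairProd P)) (inl τ : FormalGroup GB)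
    rwa [mul_assoc, mul_assoc] at this ⊢

/-! ### A homomorphism to a dihedral group recording the class of the sections -/

theorem cl_sec_mul (hcomm : ∀ b c : GB, b * c = c * b) (σ : GB →* Equiv.Perm (Fin (0 + 2)))
    (w : List GB) : cl (sec σ 0 w) * cl (sec σ 1 w) = w.prod := by
  induction w with
  | nil => simp [sec]
  | cons b w ih =>
    simp only [sec_zero_cons, sec_one_cons, map_mul, cl_inl, cl_inr, one_mul, List.prod_cons,
      mul_assoc, ← ih]
    rw [hcomm (cl (sec σ 1 w))]

theorem par_sec (σ : GB →* Equiv.Perm (Fin (0 + 2))) (w : List GB) :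
    par (sec σ 0 w) = σ (cl (sec σ 1 w)) ∧ par (sec σ 1 w) = σ (cl (sec σ 0 w)) := by
  induction w with
  | nil => simp [sec]
  | cons b w ih => simp [sec_zero_cons, sec_one_cons, ih]

theorem cl_sec_eq (σ σ' : GB →* Equiv.Perm (Fin (0 + 2))) (w : List GB) :
    cl (sec σ 0 w) = cl (sec σ' 0 w) ∧ cl (sec σ 1 w) = cl (sec σ' 1 w) := by
  induction w with
  | nil => simp [sec]
  | cons b w ih => simp [sec_zero_cons, sec_one_cons, ih]

/-- The permutations of the four words of length two. -/
abbrev Perm4 := Equiv.Perm (Fin (0 + 2) × Fin (0 + 2))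

/-- Action of a root permutation on words of length two. -/
def alphaHom : Equiv.Perm (Fin (0 + 2)) →* Perm4 where
  toFun τ := Equiv.prodCongr τ 1
  map_one' := rfl
  map_mul' _ _ := rfl

/-- Action of a permutation on the second letter of the words of length two
beginning with `1`. -/
def betaHom : Equiv.Perm (Fin (0 + 2)) →* Perm4 where
  toFun τ := Equiv.prodShear 1 fun i => if i = 1 then τ else 1
  map_one' := by ext1 ⟨i, j⟩; simp [Equiv.prodShear]
  map_mul' τ υ := by
    ext1 ⟨i, j⟩
    by_cases h : i = 1 <;> simp [Equiv.prodShear, h]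

/-- The homomorphism to the dihedral group recording how `σ` sees the sections. -/
def rho (σ : GB →* Equiv.Perm (Fin (0 + 2))) : FormalGroup GB →* Perm4 :=
  Monoid.Coprod.lift alphaHom (betaHom.comp σ)

theorem rho_inl (σ : GB →* Equiv.Perm (Fin (0 + 2))) (τ : Equiv.Perm (Fin (0 + 2))) :
    rho σ (inl τ) = alphaHom τ := by simp [rho]

theorem rho_inr (σ : GB →* Equiv.Perm (Fin (0 + 2))) (b : GB) :
    rho σ (inr b) = betaHom (σ b) := by simp [rho]

theorem alpha_beta_relations :
    alphaHom flip2 * alphaHom flip2 = 1 ∧ betaHom flip2 * betaHom flip2 = 1 := by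
  simp only [← map_mul, flip2_mul_flip2, map_one, and_self]

theorem rho_sec_mul_sec (σ : GB →* Equiv.Perm (Fin (0 + 2))) (w : List GB) :
    ∃ k : ℤ, (σ w.prod = 1 ∧ rho σ (sec σ 0 w) = (alphaHom flip2 * betaHom flip2) ^ k ∧
        rho σ (sec σ 1 w) = ((alphaHom flip2 * betaHom flip2) ^ k)⁻¹) ∨
      (σ w.prod ≠ 1 ∧
        rho σ (sec σ 0 w) = (alphaHom flip2 * betaHom flip2) ^ k * alphaHom flip2 ∧
        rho σ (sec σ 1 w) = ((alphaHom flip2 * betaHom flip2) ^ k)⁻¹ * betaHom flip2) := by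
  obtain ⟨ha, hb⟩ := alpha_beta_relations
  set α := alphaHom flip2
  set β := betaHom flip2
  have hβα : β * α = (α * β)⁻¹ := by
    rw [mul_inv_rev, ← eq_inv_of_mul_eq_one_left ha, ← eq_inv_of_mul_eq_one_left hb]
  have hα : ∀ k : ℤ, α * ((α * β) ^ k * α) = (α * β) ^ (-k) := by
    intro k
    have : α * (α * β) * α⁻¹ = (α * β)⁻¹ := by
      rw [← mul_assoc, ha, one_mul, ← hβα, ← eq_inv_of_mul_eq_one_left ha]
    rw [zpow_neg, ← inv_zpow, ← this, conj_zpow, ← eq_inv_of_mul_eq_one_left ha, mul_assoc]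
  have hβ : ∀ k : ℤ, β * ((α * β) ^ k * β) = (α * β) ^ (-k) := by
    intro k
    have : β * (α * β) * β⁻¹ = (α * β)⁻¹ := by
      rw [← mul_assoc, mul_inv_cancel_right, hβα]
    rw [zpow_neg, ← inv_zpow, ← this, conj_zpow, ← eq_inv_of_mul_eq_one_left hb, mul_assoc]
  induction w with
  | nil => exact ⟨0, by simp [sec]⟩
  | cons b w ih =>
    obtain ⟨k, ih⟩ := ih
    simp only [sec_zero_cons, sec_one_cons, map_mul, rho_inl, rho_inr, List.prod_cons]
    rcases perm_two_eq (σ b) with h | h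
    · rw [h]
      simp only [map_one, one_mul]
      rcases ih with ⟨h1, h2, h3⟩ | ⟨h1, h2, h3⟩
      · exact ⟨-k, Or.inl ⟨h1, by rw [h3, zpow_neg], by rw [h2, zpow_neg, inv_inv]⟩⟩
      · refine ⟨-k - 1, Or.inr ⟨h1, ?_, ?_⟩⟩
        · rw [h3, zpow_sub_one, zpow_neg, mul_inv_rev, ← eq_inv_of_mul_eq_one_left ha,
            ← eq_inv_of_mul_eq_one_left hb, mul_assoc, mul_assoc, ha, mul_one]
        · rw [h2, ← zpow_neg, show -(-k - 1) = k + 1 by ring, zpow_add_one, mul_assoc, mul_assoc,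
            hb, mul_one]
    · rw [h]
      rcases ih with ⟨h1, h2, h3⟩ | ⟨h1, h2, h3⟩
      · refine ⟨k - 1, Or.inr ⟨by rw [h1, mul_one]; exact flip2_ne_one, ?_, ?_⟩⟩
        · have := hβ (-k)
          rw [neg_neg, ← mul_assoc] at this
          rw [h3, ← zpow_neg, eq_mul_inv_of_mul_eq this, ← eq_inv_of_mul_eq_one_left hb,
            zpow_sub_one, mul_inv_rev, ← eq_inv_of_mul_eq_one_left ha,
            ← eq_inv_of_mul_eq_one_left hb, mul_assoc, mul_assoc, ha, mul_one]
        · have := hα k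
          rw [← mul_assoc] at this
          rw [h2, eq_mul_inv_of_mul_eq this, ← eq_inv_of_mul_eq_one_left ha, ← zpow_neg,
            show -(k - 1) = -k + 1 by ring, zpow_add_one, mul_assoc, mul_assoc, hb, mul_one]
      · refine ⟨k, Or.inl ⟨by rw [(perm_two_eq _).resolve_left h1, flip2_mul_flip2], ?_, ?_⟩⟩
        · rw [h3, ← zpow_neg, hβ, neg_neg]
        · rw [h2, hα, zpow_neg]

theorem rho_sec_mul_sec_eq_one (σ : GB →* Equiv.Perm (Fin (0 + 2))) {w : List GB}
    (hw : σ w.prod = 1) : rho σ (sec σ 0 w * sec σ 1 w) = 1 := by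
  obtain ⟨k, ⟨-, h0, h1⟩ | ⟨h, -⟩⟩ := rho_sec_mul_sec σ w
  · rw [map_mul, h0, h1, mul_inv_cancel]
  · exact absurd hw h

theorem alphaHom_apply (τ : Equiv.Perm (Fin (0 + 2))) (p : Fin (0 + 2) × Fin (0 + 2)) :
    alphaHom τ p = (τ p.1, p.2) := rfl

theorem betaHom_apply (τ : Equiv.Perm (Fin (0 + 2))) (p : Fin (0 + 2) × Fin (0 + 2)) :
    betaHom τ p = (p.1, (if p.1 = 1 then τ else 1) p.2) := rfl

theorem rho_alt_apply (σ : GB →* Equiv.Perm (Fin (0 + 2))) (w : List GB)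
    (j z : Fin (0 + 2)) :
    rho σ (alt w) (j, z) =
      (par (alt w) j, σ (cl (sec σ (par (alt w) j) w)) z) := by
  induction w with
  | nil => simp [alt, sec]
  | cons b w ih =>
    simp only [alt, map_mul, Equiv.Perm.mul_apply, ih, par_inl, par_inr, Equiv.Perm.one_apply,
      rho_inl, rho_inr]
    rcases fin_two_cases (par (alt w) j) with h | h <;> rw [h] <;>
      simp [flip2_zero, flip2_one, sec_zero_cons, sec_one_cons, alphaHom_apply, betaHom_apply]

theorem cl_sec_of_rho_eq_one {σ : GB →* Equiv.Perm (Fin (0 + 2))} {w : List GB}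
    (h : rho σ (alt w) = 1) (hw : par (alt w) = 1) (σ' : GB →* Equiv.Perm (Fin (0 + 2))) :
    σ (cl (sec σ' 0 w)) = 1 ∧ σ (cl (sec σ' 1 w)) = 1 := by
  have key : ∀ j, σ (cl (sec σ j w)) = 1 := by
    intro j
    ext1 z
    have := rho_alt_apply σ w j z
    rw [h, hw] at this
    simpa using (Prod.ext_iff.mp this).2.symm
  rw [(cl_sec_eq σ' σ w).1, (cl_sec_eq σ' σ w).2]
  exact ⟨key 0, key 1⟩

/-! ### Bounds for the order of the evaluation -/

/-- The evaluation of `γ` has order dividing `2 ^ N` as soon as `M ≤ 2 * N`. -/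
def PowBound (ω : ℕ → GB →* Equiv.Perm (Fin (0 + 2))) (s M : ℕ) (γ : FormalGroup GB) : Prop :=
  ∀ N, M ≤ 2 * N → ev ω s γ ^ 2 ^ N = 1

theorem map_eq_of_isConj {G H : Type*} [Group G] [Group H] (f : G →* H)
    (hH : ∀ x y : H, x * y = y * x) {x y : G} (h : IsConj x y) : f x = f y := by
  obtain ⟨c, rfl⟩ := isConj_iff.mp h
  rw [map_mul, map_mul, hH (f c), mul_assoc, ← map_mul, mul_inv_cancel, map_one, mul_one]

theorem map_eq_one_of_isConj {G H : Type*} [Group G] [Group H] (f : G →* H)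
    {x y : G} (h : IsConj x y) (hx : f x = 1) : f y = 1 := by
  obtain ⟨c, rfl⟩ := isConj_iff.mp h
  rw [map_mul, map_mul, hx, mul_one, ← map_mul, mul_inv_cancel, map_one]

variable {ω : ℕ → GB →* Equiv.Perm (Fin (0 + 2))}

theorem PowBound.of_isConj {s M : ℕ} {γ δ : FormalGroup GB} (h : PowBound ω s M δ)
    (hc : IsConj γ δ) : PowBound ω s M γ := by
  intro N hN
  rw [← map_pow]
  have hc' : IsConj (δ ^ 2 ^ N) (γ ^ 2 ^ N) := by
    obtain ⟨c, rfl⟩ := isConj_iff.mp hc.symm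
    exact isConj_iff.mpr ⟨c, (conj_pow).symm⟩
  exact map_eq_one_of_isConj (ev ω s) hc' (by rw [map_pow, h N hN])

theorem PowBound.mono {s M M' : ℕ} {γ : FormalGroup GB} (h : PowBound ω s M γ)
    (hM : M ≤ M') : PowBound ω s M' γ := fun N hN => h N (hM.trans hN)

theorem powBound_inr (hsq : ∀ b : GB, b * b = 1) (s : ℕ) {M : ℕ} (hM : 1 ≤ M) (b : GB) :
    PowBound ω s M (inr b) := by
  intro N hN
  obtain ⟨k, rfl⟩ : ∃ k, N = k + 1 := ⟨N - 1, by omega⟩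
  rw [pow_succ', pow_mul, pow_two, ← map_mul, ← map_mul, hsq, map_one, map_one, one_pow]

theorem powBound_alt_of_even {s M : ℕ} {w : List GB} (hw : par (alt w) = 1)
    (h : ∀ i, PowBound ω (s + 1) M (sec (ω s) i w)) : PowBound ω s M (alt w) :=
  fun N hN => ev_alt_pow_of_even ω s hw fun i => h i N hN

theorem powBound_alt_of_odd {s M : ℕ} {w : List GB} (hw : par (alt w) ≠ 1)
    (h : PowBound ω (s + 1) M (sec (ω s) 0 w * sec (ω s) 1 w)) :
    PowBound ω s (M + 2) (alt w) := by
  intro N hN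
  obtain ⟨k, rfl⟩ : ∃ k, N = k + 1 := ⟨N - 1, by omega⟩
  rw [pow_succ']
  exact ev_alt_pow_of_odd ω s hw (h k (by omega))

/-- Bound for the elements with trivial root permutation. -/
def EvenBound (ω : ℕ → GB →* Equiv.Perm (Fin (0 + 2))) (n M : ℕ) : Prop :=
  ∀ s γ, LenLt n γ → par γ = 1 → PowBound ω s M γ

/-- Bound for the elements with nontrivial root permutation and nontrivial level
class killed at distance `d`. -/
def OddBound (ω : ℕ → GB →* Equiv.Perm (Fin (0 + 2))) (d n M : ℕ) : Prop :=
  ∀ s γ, LenLt n γ → par γ ≠ 1 → cl γ ≠ 1 → ω (s + d) (cl γ) = 1 → PowBound ω s M γ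

/-- Bound for the elements with nontrivial root permutation and trivial level class. -/
def OddOneBound (ω : ℕ → GB →* Equiv.Perm (Fin (0 + 2))) (n M : ℕ) : Prop :=
  ∀ s γ, LenLt n γ → par γ ≠ 1 → cl γ = 1 → PowBound ω s M γ

/-- Bound for the elements with trivial root permutation which arise from the previous level
and whose level class is nontrivial and killed there. -/
def ConstrainedBound (ω : ℕ → GB →* Equiv.Perm (Fin (0 + 2))) (n M : ℕ) : Prop :=
  ∀ s γ, LenLt n γ → par γ = 1 → rho (ω s) γ = 1 → cl γ ≠ 1 → ω s (cl γ) = 1 →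
    PowBound ω (s + 1) M γ

/-- Bound for the elements with trivial root permutation and trivial level class. -/
def EvenOneBound (ω : ℕ → GB →* Equiv.Perm (Fin (0 + 2))) (n M : ℕ) : Prop :=
  ∀ s γ, LenLt n γ → par γ = 1 → cl γ = 1 → PowBound ω s M γ

theorem mul_comm_of_sq (hsq : ∀ b : GB, b * b = 1) (b c : GB) : b * c = c * b := by
  have h := eq_inv_of_mul_eq_one_left (hsq (b * c))
  rwa [mul_inv_rev, ← eq_inv_of_mul_eq_one_left (hsq b),
    ← eq_inv_of_mul_eq_one_left (hsq c)] at h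

theorem par_sec_mul_sec (hsq : ∀ b : GB, b * b = 1) (σ : GB →* Equiv.Perm (Fin (0 + 2)))
    (w : List GB) : par (sec σ 0 w * sec σ 1 w) = σ (cl (alt w)) := by
  rw [map_mul, (par_sec σ w).1, (par_sec σ w).2, ← map_mul, mul_comm_of_sq hsq, cl_alt,
    cl_sec_mul (mul_comm_of_sq hsq)]

theorem cl_sec_mul_sec (hsq : ∀ b : GB, b * b = 1) (σ : GB →* Equiv.Perm (Fin (0 + 2)))
    (w : List GB) : cl (sec σ 0 w * sec σ 1 w) = cl (alt w) := by
  rw [map_mul, cl_alt, cl_sec_mul (mul_comm_of_sq hsq)]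

theorem par_inr_ne_one_absurd {γ : FormalGroup GB} {b : GB} (h : par γ ≠ 1)
    (hc : IsConj γ (inr b)) : False := by
  rw [map_eq_of_isConj par perm_two_comm hc, par_inr] at h
  exact h rfl

theorem oddOneBound_of_evenOneBound (hsq : ∀ b : GB, b * b = 1) {n M : ℕ}
    (h : EvenOneBound ω n M) : OddOneBound ω n (M + 2) := by
  intro s γ hγ hpar hcl
  rcases hγ with ⟨w, hw, hc⟩ | ⟨b, hc⟩
  · refine PowBound.of_isConj ?_ hc
    rw [map_eq_of_isConj par perm_two_comm hc] at hpar
    rw [map_eq_of_isConj cl (mul_comm_of_sq hsq) hc] at hcl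
    have hodd : Odd w.length := by rwa [Ne, par_alt_eq_one_iff, Nat.not_even_iff_odd] at hpar
    refine powBound_alt_of_odd hpar (h _ _ (lenLt_sec_mul_sec_of_odd _ hodd hw) ?_ ?_)
    · rw [par_sec_mul_sec hsq, hcl, map_one]
    · rw [cl_sec_mul_sec hsq, hcl]
  · exact (par_inr_ne_one_absurd hpar hc).elim

theorem oddBound_of_constrainedBound (hsq : ∀ b : GB, b * b = 1) {n M : ℕ}
    (h : ConstrainedBound ω n M) (d : ℕ) : OddBound ω d n (M + 2 * (d + 1)) := by
  induction d with
  | zero =>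
    intro s γ hγ hpar hcl hk
    rcases hγ with ⟨w, hw, hc⟩ | ⟨b, hc⟩
    · refine PowBound.of_isConj ?_ hc
      rw [map_eq_of_isConj par perm_two_comm hc] at hpar
      rw [map_eq_of_isConj cl (mul_comm_of_sq hsq) hc] at hcl hk
      have hodd : Odd w.length := by rwa [Ne, par_alt_eq_one_iff, Nat.not_even_iff_odd] at hpar
      rw [add_zero] at hk
      refine powBound_alt_of_odd hpar (h s _ (lenLt_sec_mul_sec_of_odd _ hodd hw) ?_ ?_ ?_ ?_)
      · rw [par_sec_mul_sec hsq, hk]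
      · exact rho_sec_mul_sec_eq_one _ (by rw [← cl_alt, hk])
      · rwa [cl_sec_mul_sec hsq]
      · rwa [cl_sec_mul_sec hsq]
    · exact (par_inr_ne_one_absurd hpar hc).elim
  | succ d ih =>
    intro s γ hγ hpar hcl hk
    rcases hγ with ⟨w, hw, hc⟩ | ⟨b, hc⟩
    · refine PowBound.of_isConj ?_ hc
      rw [map_eq_of_isConj par perm_two_comm hc] at hpar
      rw [map_eq_of_isConj cl (mul_comm_of_sq hsq) hc] at hcl hk
      have hodd : Odd w.length := by rwa [Ne, par_alt_eq_one_iff, Nat.not_even_iff_odd] at hpar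
      refine powBound_alt_of_odd hpar (M := M + 2 * (d + 1)) ?_
      have hlen := lenLt_sec_mul_sec_of_odd (ω s) hodd hw
      by_cases hs : ω s (cl (alt w)) = 1
      · refine (h s _ hlen ?_ ?_ ?_ ?_).mono (by omega)
        · rw [par_sec_mul_sec hsq, hs]
        · exact rho_sec_mul_sec_eq_one _ (by rw [← cl_alt, hs])
        · rwa [cl_sec_mul_sec hsq]
        · rwa [cl_sec_mul_sec hsq]
      · refine ih (s + 1) _ hlen ?_ ?_ ?_
        · rwa [par_sec_mul_sec hsq]
        · rwa [cl_sec_mul_sec hsq]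
        · rw [cl_sec_mul_sec hsq]
          convert hk using 3
          omega
    · exact (par_inr_ne_one_absurd hpar hc).elim

/-- The conditions on the sequence used in the estimate. -/
structure Admissible (ω : ℕ → GB →* Equiv.Perm (Fin (0 + 2))) (r : ℕ) : Prop where
  two_le : 2 ≤ r
  mul_self : ∀ b : GB, b * b = 1
  ker_unique : ∀ s (b c : GB), b ≠ 1 → c ≠ 1 → ω s b = 1 → ω s c = 1 → b = c
  homogeneous : ∀ i : ℕ, ∀ b : GB, ∃ j, i ≤ j ∧ j < i + r ∧ ω j b = 1

/-- The bounds propagated by the induction on the length. -/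
structure Bounds (ω : ℕ → GB →* Equiv.Perm (Fin (0 + 2))) (r n K : ℕ) : Prop where
  even : EvenBound ω n (K + r)
  constrained : ConstrainedBound ω n K
  evenOne : EvenOneBound ω n (K + r - 2)

theorem Bounds.oddOne {r n K : ℕ} (hω : Admissible ω r) (h : Bounds ω r n K) :
    OddOneBound ω n (K + r) := by
  have := oddOneBound_of_evenOneBound hω.mul_self h.evenOne
  have h2 := hω.two_le
  rwa [show K + r - 2 + 2 = K + r by omega] at this

theorem Bounds.powBound {r n K : ℕ} (hω : Admissible ω r) (h : Bounds ω r n K) (s : ℕ)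
    {γ : FormalGroup GB} (hγ : LenLt n γ) : PowBound ω s (K + 2 * r) γ := by
  by_cases hpar : par γ = 1
  · exact (h.even s γ hγ hpar).mono (by omega)
  by_cases hcl : cl γ = 1
  · exact (h.oddOne hω s γ hγ hpar hcl).mono (by omega)
  obtain ⟨j, hj, hjr, hk⟩ := hω.homogeneous s (cl γ)
  obtain ⟨d, rfl⟩ := Nat.exists_eq_add_of_le hj
  exact (oddBound_of_constrainedBound hω.mul_self h.constrained d s γ hγ hpar hcl hk).mono
    (by omega)

theorem bounds_two {r : ℕ} (hω : Admissible ω r) : Bounds ω r 2 2 := by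
  have hr := hω.two_le
  have key : ∀ s M γ, 1 ≤ M → LenLt 2 γ → par γ = 1 → PowBound ω s M γ := by
    rintro s M γ hM (⟨w, hw, hc⟩ | ⟨b, hc⟩) hpar
    · refine PowBound.of_isConj ?_ hc
      rw [map_eq_of_isConj par perm_two_comm hc, par_alt_eq_one_iff] at hpar
      obtain ⟨k, hk⟩ := hpar
      obtain rfl : w = [] := List.length_eq_zero_iff.mp (by omega)
      intro N _
      simp [alt]
    · exact (powBound_inr hω.mul_self s hM b).of_isConj hc
  exact ⟨fun s γ hγ hpar => key s _ γ (by omega) hγ hpar,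
    fun s γ hγ hpar _ _ _ => key _ _ γ (by omega) hγ hpar,
    fun s γ hγ hpar _ => key _ _ γ (by omega) hγ hpar⟩

theorem Bounds.double {r n K : ℕ} (hω : Admissible ω r) (h : Bounds ω r n K) (hK : 1 ≤ K) :
    Bounds ω r (2 * n) (K + r) := by
  have hr := hω.two_le
  have hsq := hω.mul_self
  have hcomm := mul_comm_of_sq hsq
  refine ⟨?_, ?_, ?_⟩
  · rintro s γ (⟨w, hw, hc⟩ | ⟨b, hc⟩) hpar
    · refine PowBound.of_isConj ?_ hc
      rw [map_eq_of_isConj par perm_two_comm hc] at hpar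
      refine powBound_alt_of_even hpar fun i => ?_
      exact (h.powBound hω _ (lenLt_sec_of_even _ ((par_alt_eq_one_iff w).mp hpar) hw i)).mono
        (by omega)
    · exact (powBound_inr hsq s (by omega) b).of_isConj hc
  · rintro s γ (⟨w, hw, hc⟩ | ⟨b, hc⟩) hpar hrho hcl hk
    · refine PowBound.of_isConj ?_ hc
      rw [map_eq_of_isConj par perm_two_comm hc] at hpar
      rw [map_eq_of_isConj cl hcomm hc] at hcl hk
      have hrho := map_eq_one_of_isConj (rho (ω s)) hc hrho
      obtain ⟨hk0, hk1⟩ := cl_sec_of_rho_eq_one hrho hpar (ω (s + 1))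
      obtain ⟨hp0, hp1⟩ := par_sec (ω (s + 1)) w
      have hprod := cl_sec_mul hcomm (ω (s + 1)) w
      rw [← cl_alt] at hprod
      have hlen := lenLt_sec_of_even (ω (s + 1)) ((par_alt_eq_one_iff w).mp hpar) hw
      refine powBound_alt_of_even hpar fun i => ?_
      by_cases hpi : par (sec (ω (s + 1)) i w) = 1
      · exact h.even _ _ (hlen i) hpi
      refine h.oddOne hω _ _ (hlen i) hpi ?_
      rcases fin_two_cases i with rfl | rfl
      · rw [hp0] at hpi
        have := hω.ker_unique s _ _ (fun h1 => hpi (by rw [h1, map_one])) hcl hk1 hk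
        rwa [this, mul_eq_right] at hprod
      · rw [hp1] at hpi
        have := hω.ker_unique s _ _ (fun h1 => hpi (by rw [h1, map_one])) hcl hk0 hk
        rwa [this, mul_eq_left] at hprod
    · exact (powBound_inr hsq _ (by omega) b).of_isConj hc
  · rintro s γ (⟨w, hw, hc⟩ | ⟨b, hc⟩) hpar hcl
    · refine PowBound.of_isConj ?_ hc
      rw [map_eq_of_isConj par perm_two_comm hc] at hpar
      rw [map_eq_of_isConj cl hcomm hc] at hcl
      obtain ⟨hp0, hp1⟩ := par_sec (ω s) w
      have hprod := cl_sec_mul hcomm (ω s) w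
      rw [← cl_alt, hcl] at hprod
      have heq : cl (sec (ω s) 0 w) = cl (sec (ω s) 1 w) := by
        rw [eq_inv_of_mul_eq_one_left hprod, ← eq_inv_of_mul_eq_one_left (hsq _)]
      have hlen := lenLt_sec_of_even (ω s) ((par_alt_eq_one_iff w).mp hpar) hw
      refine powBound_alt_of_even hpar fun i => ?_
      by_cases hpi : par (sec (ω s) i w) = 1
      · exact (h.even _ _ (hlen i) hpi).mono (by omega)
      have hni : ω s (cl (sec (ω s) i w)) ≠ 1 := by
        rcases fin_two_cases i with rfl | rfl
        · rwa [heq, ← hp0]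
        · rwa [← heq, ← hp1]
      obtain ⟨j, hj, hjr, hk⟩ := hω.homogeneous s (cl (sec (ω s) i w))
      have hj1 : j ≠ s := by rintro rfl; exact hni hk
      obtain ⟨d, rfl⟩ : ∃ d, j = s + 1 + d := ⟨j - (s + 1), by omega⟩
      exact (oddBound_of_constrainedBound hsq h.constrained d _ _ (hlen i) hpi
        (fun h1 => hni (by rw [h1, map_one])) hk).mono (by omega)
    · exact (powBound_inr hsq _ (by omega) b).of_isConj hc

theorem bounds_two_pow {r : ℕ} (hω : Admissible ω r) (e : ℕ) :
    Bounds ω r (2 ^ (e + 1)) (r * e + 2) := by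
  induction e with
  | zero => simpa using bounds_two hω
  | succ e ih =>
    have := ih.double hω (by omega)
    rwa [← pow_succ', show r * e + 2 + r = r * (e + 1) + 2 by ring] at this

theorem ev_alt_pow_eq_one {r : ℕ} (hω : Admissible ω r) {e N : ℕ} {w : List GB}
    (hw : w.length < 2 ^ (e + 1)) (hN : r * e + 2 * r + 2 ≤ 2 * N) :
    ev ω 0 (alt w) ^ 2 ^ N = 1 :=
  (bounds_two_pow hω e).powBound hω 0 (Or.inl ⟨w, hw, IsConj.refl _⟩) N (by omega)

/-! ### Words over the canonical generating set -/

theorem ev_zero_inl (τ : Equiv.Perm (Fin (0 + 2))) : ev ω 0 (inl τ) = rootAut 0 τ := by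
  simp [ev]; rfl

theorem ev_zero_inr (b : GB) : ev ω 0 (inr b) = spinalAut 0 ω b := by
  simp [ev]; rfl

theorem exists_alt_of_mem_genSet {GA : Subgroup (Equiv.Perm (Fin (0 + 2)))}
    {x : Equiv.Perm (List (Fin (0 + 2)))} (hx : x ∈ genSet 0 GA ω) :
    ∃ w : List GB, w.length ≤ 2 ∧ ev ω 0 (alt w) = x := by
  obtain ⟨⟨a, -, rfl⟩ | ⟨b, rfl⟩, hne⟩ := hx
  · rcases perm_two_eq a with rfl | rfl
    · exact ⟨[], by simp, by rw [← ev_zero_inl (ω := ω)]; simp [alt]⟩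
    · exact ⟨[1], by simp, by rw [← ev_zero_inl (ω := ω)]; simp [alt]⟩
  · refine ⟨[1, b], by simp, ?_⟩
    have h : (alt [1, b] : FormalGroup GB) = inr b := by
      simp [alt, ← mul_assoc, ← map_mul, flip2_mul_flip2]
    rw [h, ev_zero_inr]

theorem exists_alt_of_list {GA : Subgroup (Equiv.Perm (Fin (0 + 2)))}
    (l : List (Equiv.Perm (List (Fin (0 + 2))))) (hl : ∀ x ∈ l, x ∈ genSet 0 GA ω) :
    ∃ w : List GB, w.length ≤ 2 * l.length ∧ ev ω 0 (alt w) = l.prod := by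
  induction l with
  | nil => exact ⟨[], by simp, by simp [alt]⟩
  | cons x l ih =>
    obtain ⟨w, hw, h⟩ := ih fun y hy => hl y (List.mem_cons_of_mem x hy)
    obtain ⟨u, hu, h'⟩ := exists_alt_of_mem_genSet (hl x List.mem_cons_self)
    exact ⟨u ++ w, by simp; omega, by rw [alt_append, map_mul, h, h', List.prod_cons]⟩

theorem mul_self_of_mem_genSet (hsq : ∀ b : GB, b * b = 1)
    {GA : Subgroup (Equiv.Perm (Fin (0 + 2)))}
    {x : Equiv.Perm (List (Fin (0 + 2)))} (hx : x ∈ genSet 0 GA ω) : x * x = 1 := by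
  obtain ⟨⟨a, -, rfl⟩ | ⟨b, rfl⟩, hne⟩ := hx
  · simp only [← ev_zero_inl (ω := ω), ← map_mul, perm_two_mul_self, map_one]
  · simp only [← ev_zero_inr, ← map_mul, hsq, map_one]

theorem exists_alt_of_wordLength_le (hsq : ∀ b : GB, b * b = 1)
    {GA : Subgroup (Equiv.Perm (Fin (0 + 2)))} {g : Equiv.Perm (List (Fin (0 + 2)))} {n : ℕ}
    (hg : g ∈ spinalGroup 0 GA ω) (hn : wordLength (genSet 0 GA ω) g ≤ n) :
    ∃ w : List GB, w.length ≤ 2 * n ∧ ev ω 0 (alt w) = g := by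
  have hne : {n | ∃ l : List (Equiv.Perm (List (Fin (0 + 2)))), l.length = n ∧
      (∀ x ∈ l, x ∈ genSet 0 GA ω) ∧ l.prod = g}.Nonempty := by
    rw [spinalGroup, ← Subgroup.mem_toSubmonoid, Subgroup.closure_toSubmonoid] at hg
    obtain ⟨l, hl, hprod⟩ := Submonoid.exists_list_of_mem_closure hg
    refine ⟨l.length, l, rfl, fun x hx => (hl x hx).elim id fun h => ?_, hprod⟩
    rw [← inv_inv x, ← eq_inv_of_mul_eq_one_left (mul_self_of_mem_genSet hsq h)]
    exact h
  obtain ⟨l, hlen, hl, hprod⟩ := Nat.sInf_mem hne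
  obtain ⟨w, hw, h⟩ := exists_alt_of_list l hl
  refine ⟨w, hw.trans ?_, h.trans hprod⟩
  rw [hlen]
  exact Nat.mul_le_mul_left 2 hn

theorem two_pow_le_rpow {r e n N : ℕ} (hr : 2 ≤ r) (he : 2 ^ e ≤ 2 * n)
    (hN : 2 * N ≤ r * e + 2 * r + 3) : (2 ^ N : ℝ) ≤ (32 * n) ^ ((r : ℝ) / 2) := by
  have h1 : (2 : ℝ) ^ (e + 4) ≤ 32 * n := by
    have : (2 : ℝ) ^ e ≤ 2 * n := by exact_mod_cast he
    rw [pow_add]; linarith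
  have h2 : (N : ℝ) ≤ ((e + 4 : ℕ) : ℝ) * (r / 2) := by
    have : 2 * N ≤ (e + 4) * r := by nlinarith
    have : (2 * N : ℝ) ≤ ((e + 4 : ℕ) : ℝ) * r := by exact_mod_cast this
    linarith
  calc (2 ^ N : ℝ) = 2 ^ (N : ℝ) := (Real.rpow_natCast 2 N).symm
    _ ≤ 2 ^ (((e + 4 : ℕ) : ℝ) * (r / 2)) := Real.rpow_le_rpow_of_exponent_le one_le_two h2
    _ = (2 ^ (e + 4)) ^ ((r : ℝ) / 2) := by
      rw [Real.rpow_mul zero_le_two, Real.rpow_natCast]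
    _ ≤ _ := Real.rpow_le_rpow (by positivity) h1 (by positivity)

theorem ker_unique_of_surjective [Finite GB] (hcard : Nat.card GB = 4)
    {f : GB →* Equiv.Perm (Fin (0 + 2))} (hf : Function.Surjective f) {b c : GB}
    (hb : b ≠ 1) (hc : c ≠ 1) (hfb : f b = 1) (hfc : f c = 1) : b = c := by
  have hindex : f.ker.index = 2 := by
    rw [Subgroup.index_ker, MonoidHom.range_eq_top.mpr hf, Subgroup.card_top, Nat.card_perm]
    simp
  have hk : Nat.card f.ker = 2 := by
    have := f.ker.card_mul_index
    rw [hindex, hcard] at this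
    omega
  obtain ⟨x, y, -, hxy⟩ := Nat.card_eq_two_iff.mp hk
  have hmem : ∀ z : f.ker, z = x ∨ z = y := fun z => by
    have : z ∈ ({x, y} : Set f.ker) := by rw [hxy]; trivial
    simpa using this
  have h1 := hmem 1
  have h2 := hmem ⟨b, hfb⟩
  have h3 := hmem ⟨c, hfc⟩
  have hb' : (⟨b, hfb⟩ : f.ker) ≠ 1 := fun h => hb (congrArg Subtype.val h)
  have hc' : (⟨c, hfc⟩ : f.ker) ≠ 1 := fun h => hc (congrArg Subtype.val h)
  have : (⟨b, hfb⟩ : f.ker) = ⟨c, hfc⟩ := by grind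
  exact congrArg Subtype.val this

/-- Period growth of Grigorchuk 2-groups: for a Grigorchuk 2-group (`q = 2`, `G_A = ℤ/2ℤ`
the full permutation group of the two-letter alphabet, `G_B` the Klein four-group), if
`ω` is `r`-homogeneous then `π_ω(n) ≾ n^{r/2}`.  (In particular, instantiating at the
3-homogeneous defining sequence `012 012 012 …`, the degree of period growth of the
first Grigorchuk group is at most `n^{3/2}`.) -/
theorem grigorchuk2Group_period_growth (GA : Subgroup (Equiv.Perm (Fin (0 + 2))))
    (hGA : GA = ⊤)
    {GB : Type*} [Group GB] [Finite GB]
    (hcard : Nat.card GB = 4) (hklein : ∀ g : GB, g ^ 2 = 1)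
    (ω : ℕ → GB →* Equiv.Perm (Fin (0 + 2)))
    (hdata : SpinalData 0 GA ω) (r : ℕ) (hr : 3 ≤ r)
    (hhom : ∀ i : ℕ, ∀ b : GB, ∃ j, i ≤ j ∧ j < i + r ∧ ω j b = 1) :
    ∃ C : ℝ, 0 < C ∧ ∀ n : ℕ, 1 ≤ n →
      (periodGrowth 0 GA ω n : ℝ) ≤ (C * n) ^ ((r : ℝ) / 2) := by
  have hω : Admissible ω r :=
    { two_le := by omega
      mul_self := fun b => by rw [← pow_two]; exact hklein b
      ker_unique := fun s b c => ker_unique_of_surjective hcard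
        (MonoidHom.range_eq_top.mp ((hdata.range_eq s).trans hGA))
      homogeneous := hhom }
  refine ⟨32, by norm_num, fun n hn => ?_⟩
  obtain ⟨e, he⟩ : ∃ e, e = Nat.log 2 (2 * n) := ⟨_, rfl⟩
  obtain ⟨N, hN⟩ : ∃ N, N = (r * e + 2 * r + 3) / 2 := ⟨_, rfl⟩
  have hlow : 2 ^ e ≤ 2 * n := he ▸ Nat.pow_log_le_self 2 (by omega)
  have hup : 2 * n < 2 ^ (e + 1) := he ▸ Nat.lt_pow_succ_log_self one_lt_two _
  refine le_trans ?_ (two_pow_le_rpow (N := N) hω.two_le hlow (by omega))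
  have hle : periodGrowth 0 GA ω n ≤ 2 ^ N := by
    refine csSup_le' ?_
    rintro _ ⟨g, ⟨hg, hgn⟩, rfl⟩
    obtain ⟨w, hw, rfl⟩ := exists_alt_of_wordLength_le hω.mul_self hg hgn
    exact orderOf_le_of_pow_eq_one (by positivity) 
      (ev_alt_pow_eq_one hω (hw.trans_lt hup) (by omega))
  exact_mod_cast hle
end Spinal
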